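/- arXiv:2102.00216 — 3 statements merged into one kernel-verified Lean document; each statement's English description precedes it below -/
import Mathlib

section
/- Fix an integer n ≥ 1. Let h : ℝ → ℝ be C² and let λ ∈ ℝ be such that, for all s ∈ ℝ: (i) −(4/n)(λ−1)h(s) + (λ−2)h'(s) + λ h''(s) ≥ 0; (ii) h(s)·(−(2/n)(λ²−1)h(s) − λ h'(s)) ≥ 0; (iii) λ h(s) ≥ 0. Then every smooth positive solution u of Δu + u h(ln u) = 0 defined on all of ℝⁿ is constant. Moreover, if in addition λ h(s) > 0 for every s ∈ ℝ, then the equation Δu + u h(ln u) = 0 admits no smooth positive solution on ℝⁿ. -/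
open Real Metric

/-- The Euclidean Laplacian: trace of the Hessian. -/
noncomputable def lap {n : ℕ} (f : EuclideanSpace ℝ (Fin n) → ℝ)
    (x : EuclideanSpace ℝ (Fin n)) : ℝ :=
  ∑ i : Fin n,
    fderiv ℝ (fun y => fderiv ℝ f y (EuclideanSpace.single i 1)) x
      (EuclideanSpace.single i 1)

section Aux

variable {n : ℕ}

/-- The `i`-th partial derivative of a function on Euclidean space. -/
noncomputable def partialDeriv (i : Fin n) (f : EuclideanSpace ℝ (Fin n) → ℝ) :
    EuclideanSpace ℝ (Fin n) → ℝ :=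
  fun x => fderiv ℝ f x (EuclideanSpace.single i 1)

local notation "∂" => partialDeriv

theorem lap_eq_sum_partialDeriv (f : EuclideanSpace ℝ (Fin n) → ℝ) (x) :
    lap f x = ∑ i, ∂ i (∂ i f) x := rfl

variable {f g : EuclideanSpace ℝ (Fin n) → ℝ} {i j : Fin n}

theorem contDiff_partialDeriv {m k : WithTop ℕ∞} (hf : ContDiff ℝ m f) (hk : k + 1 ≤ m) :
    ContDiff ℝ k (∂ i f) :=
  (hf.fderiv_right hk).clm_apply contDiff_const

theorem partialDeriv_add (hf : Differentiable ℝ f) (hg : Differentiable ℝ g) :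
    ∂ i (fun x => f x + g x) = fun x => ∂ i f x + ∂ i g x := by
  ext x
  simp [partialDeriv, fderiv_fun_add (hf x) (hg x)]

theorem partialDeriv_mul (hf : Differentiable ℝ f) (hg : Differentiable ℝ g) :
    ∂ i (fun x => f x * g x) = fun x => ∂ i f x * g x + f x * ∂ i g x := by
  ext x
  simp [partialDeriv, fderiv_fun_mul (hf x) (hg x)]
  ring

theorem partialDeriv_const_mul (c : ℝ) (hf : Differentiable ℝ f) :
    ∂ i (fun x => c * f x) = fun x => c * ∂ i f x := by
  ext x
  simp [partialDeriv, fderiv_const_mul (hf x) c]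

theorem partialDeriv_sum {ι : Type*} (s : Finset ι) {f : ι → EuclideanSpace ℝ (Fin n) → ℝ}
    (hf : ∀ k, Differentiable ℝ (f k)) :
    ∂ i (fun x => ∑ k ∈ s, f k x) = fun x => ∑ k ∈ s, ∂ i (f k) x := by
  ext x
  simp [partialDeriv, fderiv_fun_sum (fun k _ => hf k x)]

theorem partialDeriv_comp {φ : ℝ → ℝ} (hφ : Differentiable ℝ φ) (hf : Differentiable ℝ f) :
    ∂ i (fun x => φ (f x)) = fun x => deriv φ (f x) * ∂ i f x := by
  ext x
  have := ((hφ (f x)).hasDerivAt.comp_hasFDerivAt x (hf x).hasFDerivAt).fderiv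
  simp only [Function.comp_def] at this
  simp [partialDeriv, this]

theorem partialDeriv_coord : ∂ i (fun x => x j) = fun _ => if j = i then 1 else 0 := by
  ext x
  have : HasFDerivAt (fun x : EuclideanSpace ℝ (Fin n) => x j)
      (EuclideanSpace.proj j : EuclideanSpace ℝ (Fin n) →L[ℝ] ℝ) x :=
    (EuclideanSpace.proj j : EuclideanSpace ℝ (Fin n) →L[ℝ] ℝ).hasFDerivAt
  simp [partialDeriv, this.fderiv]

theorem partialDeriv_comm (hf : ContDiff ℝ 2 f) : ∂ i (∂ j f) = ∂ j (∂ i f) := by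
  ext x
  have hd : DifferentiableAt ℝ (fderiv ℝ f) x :=
    (hf.fderiv_right (m := 1) (by norm_num)).differentiable (by norm_num) x
  have hs : IsSymmSndFDerivAt ℝ f x := hf.contDiffAt.isSymmSndFDerivAt (by simp)
  have key : ∀ v w, fderiv ℝ (fun y => fderiv ℝ f y v) x w = fderiv ℝ (fderiv ℝ f) x w v := by
    intro v w
    rw [fderiv_clm_apply hd (differentiableAt_const v)]
    simp
  change fderiv ℝ (fun y => fderiv ℝ f y _) x _ = fderiv ℝ (fun y => fderiv ℝ f y _) x _
  rw [key, key]
  exact hs _ _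

theorem partialDeriv_eq_zero_of_isLocalMax {x} (hx : IsLocalMax f x) : ∂ i f x = 0 := by
  simp [partialDeriv, hx.fderiv_eq_zero]

theorem deriv_comp_line (hf : Differentiable ℝ f) (x : EuclideanSpace ℝ (Fin n)) :
    deriv (fun t : ℝ => f (x + t • EuclideanSpace.single i 1)) =
      fun t => ∂ i f (x + t • EuclideanSpace.single i 1) := by
  ext t
  have hl : HasDerivAt (fun t : ℝ => x + t • EuclideanSpace.single i (1 : ℝ))
      (EuclideanSpace.single i (1 : ℝ)) t := by
    simpa using ((hasDerivAt_id t).smul_const (EuclideanSpace.single i (1 : ℝ))).const_add x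
  exact ((hf _).hasFDerivAt.comp_hasDerivAt t hl).deriv

theorem deriv_deriv_nonpos_of_isLocalMax {φ : ℝ → ℝ} {t : ℝ} (hc : ContinuousAt φ t)
    (hm : IsLocalMax φ t) : deriv (deriv φ) t ≤ 0 := by
  by_contra! hpos
  have hmin := isLocalMin_of_deriv_deriv_pos hpos hm.deriv_eq_zero hc
  have hconst : φ =ᶠ[nhds t] fun _ => φ t := by
    filter_upwards [hm, hmin] with s h1 h2 using le_antisymm h1 h2
  have := hconst.deriv.deriv_eq
  simp at this
  linarith

theorem lap_nonpos_of_isLocalMax {x} (hf : ContDiff ℝ 2 f) (hx : IsLocalMax f x) :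
    lap f x ≤ 0 := by
  rw [lap_eq_sum_partialDeriv]
  refine Finset.sum_nonpos fun i _ => ?_
  have hcont : Continuous fun t : ℝ => x + t • EuclideanSpace.single i (1 : ℝ) := by fun_prop
  have hmax : IsLocalMax (fun t : ℝ => f (x + t • EuclideanSpace.single i 1)) 0 := by
    have ht := hcont.tendsto 0
    simp only [zero_smul, add_zero] at ht
    simpa [IsLocalMax, IsMaxFilter] using ht.eventually hx
  have hcf : Continuous fun t : ℝ => f (x + t • EuclideanSpace.single i 1) :=
    hf.continuous.comp hcont
  have := deriv_deriv_nonpos_of_isLocalMax hcf.continuousAt hmax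
  rw [deriv_comp_line (hf.differentiable (by norm_num)),
    deriv_comp_line ((contDiff_partialDeriv (k := 1) hf (by norm_num)).differentiable
      (by norm_num))] at this
  simpa using this

theorem lap_add (hf : ContDiff ℝ 2 f) (hg : ContDiff ℝ 2 g) (x) :
    lap (fun x => f x + g x) x = lap f x + lap g x := by
  have hf' (i) : Differentiable ℝ (∂ i f) :=
    (contDiff_partialDeriv (k := 1) hf (by norm_num)).differentiable (by norm_num)
  have hg' (i) : Differentiable ℝ (∂ i g) :=
    (contDiff_partialDeriv (k := 1) hg (by norm_num)).differentiable (by norm_num)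
  simp only [lap_eq_sum_partialDeriv, partialDeriv_add (hf.differentiable (by norm_num))
    (hg.differentiable (by norm_num)), partialDeriv_add (hf' _) (hg' _), Finset.sum_add_distrib]

theorem lap_const_mul (c : ℝ) (hf : ContDiff ℝ 2 f) (x) :
    lap (fun x => c * f x) x = c * lap f x := by
  have hf' (i) : Differentiable ℝ (∂ i f) :=
    (contDiff_partialDeriv (k := 1) hf (by norm_num)).differentiable (by norm_num)
  simp only [lap_eq_sum_partialDeriv, partialDeriv_const_mul c (hf.differentiable (by norm_num)),
    partialDeriv_const_mul c (hf' _), Finset.mul_sum]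

theorem lap_mul (hf : ContDiff ℝ 2 f) (hg : ContDiff ℝ 2 g) (x) :
    lap (fun x => f x * g x) x =
      lap f x * g x + 2 * ∑ i, ∂ i f x * ∂ i g x + f x * lap g x := by
  have hf0 : Differentiable ℝ f := hf.differentiable (by norm_num)
  have hg0 : Differentiable ℝ g := hg.differentiable (by norm_num)
  have hf' (i) : Differentiable ℝ (∂ i f) :=
    (contDiff_partialDeriv (k := 1) hf (by norm_num)).differentiable (by norm_num)
  have hg' (i) : Differentiable ℝ (∂ i g) :=
    (contDiff_partialDeriv (k := 1) hg (by norm_num)).differentiable (by norm_num)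
  have h1 (i) : Differentiable ℝ fun x => ∂ i f x * g x := (hf' i).mul hg0
  have h2 (i) : Differentiable ℝ fun x => f x * ∂ i g x := hf0.mul (hg' i)
  simp only [lap_eq_sum_partialDeriv, partialDeriv_mul hf0 hg0,
    partialDeriv_add (h1 _) (h2 _), partialDeriv_mul (hf' _) hg0,
    partialDeriv_mul hf0 (hg' _), Finset.mul_sum, Finset.sum_mul, ← Finset.sum_add_distrib]
  exact Finset.sum_congr rfl fun i _ => by ring

theorem lap_sum {ι : Type*} (s : Finset ι) {f : ι → EuclideanSpace ℝ (Fin n) → ℝ}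
    (hf : ∀ k, ContDiff ℝ 2 (f k)) (x) :
    lap (fun x => ∑ k ∈ s, f k x) x = ∑ k ∈ s, lap (f k) x := by
  have hf' (i k) : Differentiable ℝ (∂ i (f k)) :=
    (contDiff_partialDeriv (k := 1) (hf k) (by norm_num)).differentiable (by norm_num)
  simp only [lap_eq_sum_partialDeriv,
    partialDeriv_sum s (fun k => (hf k).differentiable (by norm_num)),
    partialDeriv_sum s (hf' _)]
  exact Finset.sum_comm

theorem lap_comp {φ : ℝ → ℝ} (hφ : ContDiff ℝ 2 φ) (hf : ContDiff ℝ 2 f) (x) :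
    lap (fun x => φ (f x)) x =
      deriv (deriv φ) (f x) * ∑ i, ∂ i f x ^ 2 + deriv φ (f x) * lap f x := by
  have hf0 : Differentiable ℝ f := hf.differentiable (by norm_num)
  have hf' (i) : Differentiable ℝ (∂ i f) :=
    (contDiff_partialDeriv (k := 1) hf (by norm_num)).differentiable (by norm_num)
  have hφ' : Differentiable ℝ (deriv φ) :=
    (hφ.deriv' (n := 1)).differentiable (by norm_num)
  have hφf : Differentiable ℝ fun x => deriv φ (f x) := hφ'.comp hf0
  simp only [lap_eq_sum_partialDeriv, partialDeriv_comp (hφ.differentiable (by norm_num)) hf0,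
    partialDeriv_mul hφf (hf' _),
    partialDeriv_comp hφ' hf0, Finset.mul_sum, ← Finset.sum_add_distrib]
  exact Finset.sum_congr rfl fun i _ => by ring

theorem partialDeriv_lap (hf : ContDiff ℝ 3 f) : ∂ j (lap f) = lap (∂ j f) := by
  have h1 (i) : ContDiff ℝ 2 (∂ i f) := contDiff_partialDeriv hf (by norm_num)
  have h2 (i) : Differentiable ℝ (∂ i (∂ i f)) :=
    (contDiff_partialDeriv (k := 1) (h1 i) (by norm_num)).differentiable (by norm_num)
  have : lap f = fun x => ∑ i, ∂ i (∂ i f) x := rfl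
  rw [this, partialDeriv_sum _ h2]
  ext x
  rw [lap_eq_sum_partialDeriv]
  refine Finset.sum_congr rfl fun i _ => ?_
  rw [partialDeriv_comm (h1 i), partialDeriv_comm (i := j) (j := i) (hf.of_le (by norm_num))]

/-- The squared norm of the gradient. -/
noncomputable def gradSq (f : EuclideanSpace ℝ (Fin n) → ℝ) (x : EuclideanSpace ℝ (Fin n)) : ℝ :=
  ∑ i, ∂ i f x ^ 2

theorem contDiff_gradSq (hf : ContDiff ℝ 3 f) : ContDiff ℝ 2 (gradSq f) :=
  ContDiff.sum fun i _ => (contDiff_partialDeriv (i := i) hf (by norm_num)).pow 2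

/-- Bochner's formula, with the Hessian estimated below by its trace. -/
theorem bochner_le_lap_gradSq (hf : ContDiff ℝ 3 f) (x) :
    2 / (n : ℝ) * lap f x ^ 2 + 2 * ∑ j, ∂ j f x * ∂ j (lap f) x ≤ lap (gradSq f) x := by
  have h1 (i) : ContDiff ℝ 2 (∂ i f) := contDiff_partialDeriv hf (by norm_num)
  have hG : gradSq f = fun x => ∑ j, ∂ j f x * ∂ j f x := by
    ext x; simp only [gradSq, sq]
  have hlap : lap (gradSq f) x =
      2 * ∑ j, ∑ i, ∂ i (∂ j f) x ^ 2 + 2 * ∑ j, ∂ j f x * ∂ j (lap f) x := by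
    rw [hG, lap_sum _ fun j => (h1 j).mul (h1 j)]
    simp only [lap_mul (h1 _) (h1 _), partialDeriv_lap hf, Finset.mul_sum,
      ← Finset.sum_add_distrib]
    refine Finset.sum_congr rfl fun j _ => ?_
    have : ∑ i, 2 * (∂ i (∂ j f) x * ∂ i (∂ j f) x) = ∑ i, 2 * ∂ i (∂ j f) x ^ 2 :=
      Finset.sum_congr rfl fun i _ => by ring
    rw [this]
    ring
  have hdiag : ∑ j, ∂ j (∂ j f) x ^ 2 ≤ ∑ j, ∑ i, ∂ i (∂ j f) x ^ 2 :=
    Finset.sum_le_sum fun j _ => Finset.single_le_sum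
      (f := fun i => ∂ i (∂ j f) x ^ 2) (fun i _ => sq_nonneg _) (Finset.mem_univ j)
  have hcs : lap f x ^ 2 ≤ n * ∑ j, ∂ j (∂ j f) x ^ 2 := by
    simpa [lap_eq_sum_partialDeriv] using
      sq_sum_le_card_mul_sum_sq (s := Finset.univ) (f := fun j => ∂ j (∂ j f) x)
  have htr : 2 / (n : ℝ) * lap f x ^ 2 ≤ 2 * ∑ j, ∂ j (∂ j f) x ^ 2 := by
    rcases Nat.eq_zero_or_pos n with rfl | hn
    · simp
    · have hn' : (0 : ℝ) < n := by exact_mod_cast hn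
      rw [div_mul_eq_mul_div, div_le_iff₀ hn']
      linarith
  rw [hlap]
  linarith

theorem lap_log_add_gradSq_log {u : EuclideanSpace ℝ (Fin n) → ℝ} (hu : ContDiff ℝ 2 u)
    (hpos : ∀ x, 0 < u x) (x) :
    u x * (lap (fun x => Real.log (u x)) x + gradSq (fun x => Real.log (u x)) x) = lap u x := by
  have hw : ContDiff ℝ 2 (fun x => Real.log (u x)) := hu.log fun x => (hpos x).ne'
  have hexp : u = fun x => Real.exp (Real.log (u x)) := by
    ext x; rw [Real.exp_log (hpos x)]
  have := lap_comp Real.contDiff_exp hw x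
  rw [← hexp] at this
  simp only [Real.deriv_exp, Real.exp_log (hpos x)] at this
  rw [this, gradSq]
  ring

/-- The differential inequality satisfied by `|∇w|² + λ h(w)`. -/
theorem sq_le_lap_gradSq_add_comp {w : EuclideanSpace ℝ (Fin n) → ℝ} {h : ℝ → ℝ} {lam : ℝ}
    (hh : ContDiff ℝ 2 h)
    (h1 : ∀ s : ℝ, -(4 / (n : ℝ)) * (lam - 1) * h s + (lam - 2) * deriv h s
        + lam * deriv (deriv h) s ≥ 0)
    (h2 : ∀ s : ℝ, h s * (-(2 / (n : ℝ)) * (lam ^ 2 - 1) * h s - lam * deriv h s) ≥ 0)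
    (hw : ContDiff ℝ 3 w) (heq : ∀ x, lap w x + gradSq w x + h (w x) = 0) (x) :
    2 / (n : ℝ) * (gradSq w x + lam * h (w x)) ^ 2 ≤
      lap (fun x => gradSq w x + lam * h (w x)) x +
        2 * ∑ i, ∂ i w x * ∂ i (fun x => gradSq w x + lam * h (w x)) x := by
  have hw2 : ContDiff ℝ 2 w := hw.of_le (by norm_num)
  have hw0 : Differentiable ℝ w := hw.differentiable (by norm_num)
  have hG := contDiff_gradSq hw
  have hG0 : Differentiable ℝ (gradSq w) := hG.differentiable (by norm_num)
  have hhw : ContDiff ℝ 2 (fun x => h (w x)) := hh.comp hw2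
  have hhw0 : Differentiable ℝ (fun x => h (w x)) := hhw.differentiable (by norm_num)
  have hlap : lap w = fun x => (-1) * (gradSq w x + h (w x)) := by
    ext x; linarith [heq x]
  have hb := bochner_le_lap_gradSq hw x
  have hcross : ∑ j, ∂ j w x * ∂ j (lap w) x =
      -(∑ j, ∂ j w x * ∂ j (gradSq w) x) - deriv h (w x) * gradSq w x := by
    rw [hlap]
    have hsum : Differentiable ℝ fun x => gradSq w x + h (w x) := hG0.add hhw0
    simp only [partialDeriv_const_mul (-1) hsum, partialDeriv_add hG0 hhw0,
      partialDeriv_comp (hh.differentiable (by norm_num)) hw0]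
    simp only [gradSq, Finset.mul_sum, ← Finset.sum_neg_distrib, ← Finset.sum_sub_distrib]
    exact Finset.sum_congr rfl fun i _ => by ring
  have hcross' : ∑ i, ∂ i w x * ∂ i (fun x => gradSq w x + lam * h (w x)) x =
      (∑ j, ∂ j w x * ∂ j (gradSq w) x) + lam * deriv h (w x) * gradSq w x := by
    simp only [partialDeriv_add hG0 (hhw0.const_mul lam), partialDeriv_const_mul lam hhw0,
      partialDeriv_comp (hh.differentiable (by norm_num)) hw0]
    simp only [gradSq, Finset.mul_sum, ← Finset.sum_add_distrib]
    exact Finset.sum_congr rfl fun i _ => by ring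
  have hlw : lap w x = -(gradSq w x + h (w x)) := by linarith [heq x]
  rw [hcross', lap_add hG (contDiff_const.mul hhw), lap_const_mul lam hhw, lap_comp hh hw2]
  rw [hcross, hlw] at hb
  have hg0 : 0 ≤ gradSq w x := Finset.sum_nonneg fun i _ => sq_nonneg _
  have e1 := mul_nonneg hg0 (h1 (w x))
  have e2 := h2 (w x)
  change _ ≤ _ + lam * (_ * gradSq w x + _) + _
  rw [hlw]
  have hid : 2 / (n : ℝ) * (-(gradSq w x + h (w x))) ^ 2 =
      2 / (n : ℝ) * (gradSq w x + lam * h (w x)) ^ 2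
      + gradSq w x * (-(4 / (n : ℝ)) * (lam - 1) * h (w x))
      + h (w x) * (-(2 / (n : ℝ)) * (lam ^ 2 - 1) * h (w x)) := by ring
  nlinarith [hb, e1, e2, hid]

/-- The cutoff `R - |x|²`, written in coordinates. -/
noncomputable def cutoff (R : ℝ) (x : EuclideanSpace ℝ (Fin n)) : ℝ := R + (-1) * ∑ i, x i * x i

theorem cutoff_eq (R : ℝ) (x : EuclideanSpace ℝ (Fin n)) : cutoff R x = R - ‖x‖ ^ 2 := by
  rw [EuclideanSpace.norm_sq_eq]
  simp [cutoff, sq, sub_eq_add_neg]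

theorem contDiff_cutoff (R : ℝ) : ContDiff ℝ 2 (cutoff (n := n) R) := by
  unfold cutoff
  fun_prop

theorem partialDeriv_cutoff (R : ℝ) : ∂ i (cutoff R) = fun x => (-2) * x i := by
  have hc (j : Fin n) : Differentiable ℝ fun x : EuclideanSpace ℝ (Fin n) => x j := by fun_prop
  have hcc (j : Fin n) : Differentiable ℝ fun x : EuclideanSpace ℝ (Fin n) => x j * x j :=
    (hc j).mul (hc j)
  have hs : Differentiable ℝ fun x : EuclideanSpace ℝ (Fin n) => ∑ j, x j * x j := by fun_prop
  have hconst : ∂ i (fun _ => R) = fun _ => 0 := by ext x; simp [partialDeriv]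
  unfold cutoff
  rw [partialDeriv_add (differentiable_const R) (hs.const_mul (-1)),
    partialDeriv_const_mul (-1) hs, partialDeriv_sum _ hcc, hconst]
  simp only [partialDeriv_mul (hc _) (hc _), partialDeriv_coord]
  ext x
  simp [Finset.sum_add_distrib]
  ring

theorem lap_cutoff (R : ℝ) (x : EuclideanSpace ℝ (Fin n)) : lap (cutoff R) x = -2 * n := by
  have hc (j : Fin n) : Differentiable ℝ fun x : EuclideanSpace ℝ (Fin n) => x j := by fun_prop
  simp only [lap_eq_sum_partialDeriv, partialDeriv_cutoff, partialDeriv_const_mul _ (hc _),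
    partialDeriv_coord]
  simp
  ring

/-- At a local maximum of `(R - |x|²)² F` the differential inequality bounds this quantity. -/
theorem cutoff_sq_mul_le_of_isLocalMax (hn : 1 ≤ n) {F w : EuclideanSpace ℝ (Fin n) → ℝ}
    {R : ℝ} {x : EuclideanSpace ℝ (Fin n)} (hF : ContDiff ℝ 2 F)
    (hineq : 2 / (n : ℝ) * F x ^ 2 ≤ lap F x + 2 * ∑ i, ∂ i w x * ∂ i F x)
    (hle : gradSq w x ≤ F x) (hFx : 0 < F x) (hq : 0 < cutoff R x)
    (hmax : IsLocalMax (fun x => cutoff R x * cutoff R x * F x) x) :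
    cutoff R x * cutoff R x * F x ≤ n * (24 + 20 * n) * R := by
  have hn' : (0 : ℝ) < n := by exact_mod_cast hn
  have hc := contDiff_cutoff (n := n) R
  have hcd : Differentiable ℝ (cutoff (n := n) R) := hc.differentiable (by norm_num)
  have hFd : Differentiable ℝ F := hF.differentiable (by norm_num)
  have hcc : ContDiff ℝ 2 (fun x : EuclideanSpace ℝ (Fin n) => cutoff R x * cutoff R x) :=
    hc.mul hc
  have hccd : Differentiable ℝ (fun x : EuclideanSpace ℝ (Fin n) => cutoff R x * cutoff R x) :=
    hcd.mul hcd
  have hfirst (i) : cutoff R x * ∂ i F x = 4 * F x * x i := by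
    have := partialDeriv_eq_zero_of_isLocalMax (i := i) hmax
    simp only [partialDeriv_mul hccd hFd, partialDeriv_mul hcd hcd, partialDeriv_cutoff] at this
    have h0 : cutoff R x * (cutoff R x * ∂ i F x - 4 * F x * x i) = 0 := by linarith
    rcases mul_eq_zero.1 h0 with h0 | h0
    · exact absurd h0 hq.ne'
    · linarith
  have hsecond := lap_nonpos_of_isLocalMax (hcc.mul hF) hmax
  rw [lap_mul hcc hF, lap_mul hc hc] at hsecond
  simp only [partialDeriv_mul hcd hcd, partialDeriv_cutoff, lap_cutoff] at hsecond
  have hr : ∑ i, x i * x i = R - cutoff R x := by simp [cutoff]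
  have hr0 : 0 ≤ ∑ i, x i * x i := Finset.sum_nonneg fun i _ => mul_self_nonneg _
  have e1 : ∑ i, -2 * x i * (-2 * x i) = 4 * ∑ i, x i * x i := by
    rw [Finset.mul_sum]; exact Finset.sum_congr rfl fun i _ => by ring
  have e2 : ∑ i, (-2 * x i * cutoff R x + cutoff R x * (-2 * x i)) * ∂ i F x =
      -16 * F x * ∑ i, x i * x i := by
    rw [Finset.mul_sum]
    refine Finset.sum_congr rfl fun i _ => ?_
    linear_combination (-4 * x i) * hfirst i
  have e3 : cutoff R x * ∑ i, ∂ i w x * ∂ i F x = 4 * F x * ∑ i, ∂ i w x * x i := by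
    rw [Finset.mul_sum, Finset.mul_sum]
    refine Finset.sum_congr rfl fun i _ => ?_
    linear_combination (∂ i w x) * hfirst i
  have e4 : 8 * cutoff R x * ∑ i, ∂ i w x * x i ≤
      cutoff R x ^ 2 / n * gradSq w x + 16 * n * ∑ i, x i * x i := by
    simp only [gradSq, Finset.mul_sum, ← Finset.sum_add_distrib]
    refine Finset.sum_le_sum fun i _ => ?_
    have hs := div_nonneg (sq_nonneg (cutoff R x * ∂ i w x - 4 * n * x i)) hn'.le
    have : (cutoff R x * ∂ i w x - 4 * n * x i) ^ 2 / n =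
        cutoff R x ^ 2 / n * ∂ i w x ^ 2 + 16 * n * (x i * x i)
          - 8 * cutoff R x * (∂ i w x * x i) := by
      field_simp
      ring
    linarith
  rw [e1, e2] at hsecond
  set q := cutoff R x
  set r := ∑ i, x i * x i
  set S := ∑ i, ∂ i w x * x i
  have e5 : q ^ 2 * (2 / (n : ℝ) * F x ^ 2) ≤ q ^ 2 * lap F x + 8 * q * F x * S := by
    have := mul_le_mul_of_nonneg_left hineq (sq_nonneg q)
    linear_combination this + 2 * q * e3
  have e6 : F x * (2 / (n : ℝ) * q ^ 2 * F x) ≤ F x * (24 * r + 4 * n * q + 8 * q * S) := by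
    linarith
  have e7 := le_of_mul_le_mul_left e6 hFx
  have e8 : q ^ 2 / n * gradSq w x ≤ q ^ 2 / n * F x := by gcongr
  have e9 : q ^ 2 / n * F x ≤ (24 + 20 * n) * R := by
    have hr' : r ≤ R := by linarith
    have hq' : n * q ≤ n * R := by gcongr; linarith
    have hnr : n * r ≤ n * R := by gcongr
    have : 2 / (n : ℝ) * q ^ 2 * F x = 2 * (q ^ 2 / n * F x) := by ring
    linarith
  calc q * q * F x = n * (q ^ 2 / n * F x) := by field_simp
    _ ≤ n * ((24 + 20 * n) * R) := by gcongr
    _ = _ := by ring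

theorem exists_isLocalMax_cutoff {F : EuclideanSpace ℝ (Fin n) → ℝ} (hF : Continuous F) {R : ℝ}
    {x₀ : EuclideanSpace ℝ (Fin n)} (hx₀ : 0 < cutoff R x₀) (hFx₀ : 0 < F x₀) :
    ∃ x, 0 < cutoff R x ∧ 0 < F x ∧ IsLocalMax (fun x => cutoff R x * cutoff R x * F x) x ∧
      cutoff R x₀ * cutoff R x₀ * F x₀ ≤ cutoff R x * cutoff R x * F x := by
  have hc : Continuous (cutoff (n := n) R) := (contDiff_cutoff R).continuous
  have hcpt : IsCompact {x : EuclideanSpace ℝ (Fin n) | 0 ≤ cutoff R x} := by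
    refine Metric.isCompact_of_isClosed_isBounded (isClosed_le continuous_const hc) ?_
    refine (Metric.isBounded_closedBall (x := 0) (r := Real.sqrt R)).subset fun x hx => ?_
    rw [mem_closedBall_zero_iff]
    apply Real.le_sqrt_of_sq_le
    have : 0 ≤ cutoff R x := hx
    rw [cutoff_eq] at this
    linarith
  obtain ⟨x, hx, hxmax⟩ := hcpt.exists_isMaxOn ⟨x₀, hx₀.le⟩
    (f := fun x => cutoff R x * cutoff R x * F x) (by fun_prop)
  have hge : cutoff R x₀ * cutoff R x₀ * F x₀ ≤ cutoff R x * cutoff R x * F x :=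
    hxmax (show 0 ≤ cutoff R x₀ from hx₀.le)
  have hpos : 0 < cutoff R x * cutoff R x * F x := lt_of_lt_of_le (by positivity) hge
  have hcx : 0 < cutoff R x :=
    lt_of_le_of_ne hx fun h0 => by rw [← h0] at hpos; simp at hpos
  refine ⟨x, hcx, pos_of_mul_pos_right hpos (by positivity), ?_, hge⟩
  filter_upwards [(isOpen_lt continuous_const hc).mem_nhds hcx] with y hy
  exact hxmax (show 0 ≤ cutoff R y from le_of_lt hy)

theorem nonpos_of_sq_le_lap_add (hn : 1 ≤ n) {F w : EuclideanSpace ℝ (Fin n) → ℝ}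
    (hF : ContDiff ℝ 2 F)
    (hineq : ∀ x, 2 / (n : ℝ) * F x ^ 2 ≤ lap F x + 2 * ∑ i, ∂ i w x * ∂ i F x)
    (hle : ∀ x, gradSq w x ≤ F x) (x : EuclideanSpace ℝ (Fin n)) : F x ≤ 0 := by
  by_contra! hpos
  set C : ℝ := n * (24 + 20 * n)
  have hC : 0 ≤ C := by positivity
  have hbound (s : ℝ) (hs : 0 < s) : s ^ 2 * F x ≤ C * (s + ‖x‖ ^ 2) := by
    have hcx : cutoff (s + ‖x‖ ^ 2) x = s := by rw [cutoff_eq]; ring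
    obtain ⟨y, hy, hFy, hmax, hge⟩ :=
      exists_isLocalMax_cutoff hF.continuous (hcx.symm ▸ hs) hpos
    have := cutoff_sq_mul_le_of_isLocalMax hn hF (hineq y) (hle y) hFy hy hmax
    rw [hcx] at hge
    linarith [sq s]
  set a := ‖x‖ ^ 2
  have ha : 0 ≤ a := by positivity
  set s := max 1 ((C + 1) * (1 + a) / F x)
  have hs1 : 1 ≤ s := le_max_left _ _
  have hs2 : (C + 1) * (1 + a) ≤ s * F x := (div_le_iff₀ hpos).1 (le_max_right _ _)
  have h1 := hbound s (by linarith)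
  have h2 : s * ((C + 1) * (1 + a)) ≤ s * (s * F x) := by gcongr
  nlinarith [mul_nonneg hC (mul_nonneg ha (sub_nonneg.2 hs1)), mul_nonneg ha (by linarith : 0 ≤ s)]

theorem gradSq_eq_zero_iff {x} : gradSq f x = 0 ↔ fderiv ℝ f x = 0 := by
  constructor
  · intro h
    have hi : ∀ i, ∂ i f x = 0 := fun i => by
      simpa using (Finset.sum_eq_zero_iff_of_nonneg (fun i _ => sq_nonneg (∂ i f x))).1 h i
        (Finset.mem_univ i)
    refine ContinuousLinearMap.coe_injective
      ((EuclideanSpace.basisFun (Fin n) ℝ).toBasis.ext fun i => ?_)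
    simpa [partialDeriv] using hi i
  · intro h
    simp [gradSq, partialDeriv, h]

/-- For a positive solution `u`, both `|∇ log u|²` and `λ h(log u)` vanish. -/
theorem gradSq_log_eq_zero_and_comp_nonpos (hn : 1 ≤ n) {h : ℝ → ℝ} {lam : ℝ}
    (hh : ContDiff ℝ 2 h)
    (h1 : ∀ s : ℝ, -(4 / (n : ℝ)) * (lam - 1) * h s + (lam - 2) * deriv h s
        + lam * deriv (deriv h) s ≥ 0)
    (h2 : ∀ s : ℝ, h s * (-(2 / (n : ℝ)) * (lam ^ 2 - 1) * h s - lam * deriv h s) ≥ 0)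
    (h3 : ∀ s : ℝ, lam * h s ≥ 0) {u : EuclideanSpace ℝ (Fin n) → ℝ} (hu : ContDiff ℝ 3 u)
    (hpos : ∀ x, 0 < u x) (heq : ∀ x, lap u x + u x * h (Real.log (u x)) = 0) (x) :
    gradSq (fun x => Real.log (u x)) x = 0 ∧ lam * h (Real.log (u x)) ≤ 0 := by
  have hw : ContDiff ℝ 3 (fun x => Real.log (u x)) := hu.log fun x => (hpos x).ne'
  have heqw (x) : lap (fun x => Real.log (u x)) x + gradSq (fun x => Real.log (u x)) x
      + h (Real.log (u x)) = 0 := by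
    have hx := heq x
    rw [← lap_log_add_gradSq_log (hu.of_le (by norm_num)) hpos x, ← mul_add] at hx
    exact (mul_eq_zero.1 hx).resolve_left (hpos x).ne'
  have hF := nonpos_of_sq_le_lap_add hn
    ((contDiff_gradSq hw).add (contDiff_const.mul (hh.comp (hw.of_le (by norm_num)))))
    (sq_le_lap_gradSq_add_comp hh h1 h2 hw heqw)
    (fun x => le_add_of_nonneg_right (h3 _)) x
  have hg0 : 0 ≤ gradSq (fun x => Real.log (u x)) x := Finset.sum_nonneg fun i _ => sq_nonneg _
  have h3x := h3 (Real.log (u x))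
  simp only [Function.comp_apply] at hF
  constructor <;> linarith

end Aux

/-- Corollary 1.2 (Euclidean case): Liouville theorem. Under the structural conditions
(1.9) with `K = 0`, every global smooth positive solution of `Δu + u h(ln u) = 0` on `ℝⁿ`
is constant; and if moreover `λ h > 0` everywhere, no global smooth positive solution
exists. -/
theorem stmt_6 (n : ℕ) (hn : 1 ≤ n) (h : ℝ → ℝ) (lam : ℝ) (hh : ContDiff ℝ 2 h)
    (h1 : ∀ s : ℝ, -(4 / (n : ℝ)) * (lam - 1) * h s + (lam - 2) * deriv h s
        + lam * deriv (deriv h) s ≥ 0)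
    (h2 : ∀ s : ℝ, h s * (-(2 / (n : ℝ)) * (lam ^ 2 - 1) * h s - lam * deriv h s) ≥ 0)
    (h3 : ∀ s : ℝ, lam * h s ≥ 0) :
    (∀ u : EuclideanSpace ℝ (Fin n) → ℝ,
      ContDiff ℝ (⊤ : ℕ∞) u → (∀ x, 0 < u x) →
      (∀ x, lap u x + u x * h (Real.log (u x)) = 0) →
      ∀ x y, u x = u y) ∧
    ((∀ s : ℝ, 0 < lam * h s) →
      ¬ ∃ u : EuclideanSpace ℝ (Fin n) → ℝ,
        ContDiff ℝ (⊤ : ℕ∞) u ∧ (∀ x, 0 < u x) ∧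
        (∀ x, lap u x + u x * h (Real.log (u x)) = 0)) := by
  refine ⟨fun u hu hpos heq x y => ?_, fun hlam => ?_⟩
  · have hu3 : ContDiff ℝ 3 u := hu.of_le (WithTop.coe_le_coe.2 le_top)
    have hw : Differentiable ℝ (fun x => Real.log (u x)) :=
      (hu3.log fun x => (hpos x).ne').differentiable (by norm_num)
    refine Real.log_injOn_pos (hpos x) (hpos y) (is_const_of_fderiv_eq_zero hw (fun z => ?_) x y)
    exact gradSq_eq_zero_iff.1
      (gradSq_log_eq_zero_and_comp_nonpos hn hh h1 h2 h3 hu3 hpos heq z).1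
  · rintro ⟨u, hu, hpos, heq⟩
    have hu3 : ContDiff ℝ 3 u := hu.of_le (WithTop.coe_le_coe.2 le_top)
    exact (hlam _).not_ge
      (gradSq_log_eq_zero_and_comp_nonpos hn hh h1 h2 h3 hu3 hpos heq 0).2
end

section
/- Let n ≥ 1 and let c > 0 and d ≤ 0 be real constants. There is no smooth positive function u : ℝⁿ → ℝ satisfying Δu + c·u^{d+1} = 0 on all of ℝⁿ. -/
open Real Metric

/-- The second derivative is nonnegative at a local minimum. -/
theorem IsLocalMin.second_deriv_nonneg {g g₁ : ℝ → ℝ} {a g₂ : ℝ} (hmin : IsLocalMin g a)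
    (hg : ∀ t, HasDerivAt g (g₁ t) t) (hg₁ : HasDerivAt g₁ g₂ a) : 0 ≤ g₂ := by
  by_contra! hneg
  have hderiv : deriv g = g₁ := funext fun t => (hg t).deriv
  have hmax : IsLocalMax g a :=
    isLocalMax_of_deriv_deriv_neg (by rwa [hderiv, hg₁.deriv]) hmin.deriv_eq_zero
      (hg a).continuousAt
  have hconst : g =ᶠ[nhds a] fun _ => g a := by
    filter_upwards [hmin, hmax] with t h₁ h₂ using le_antisymm h₂ h₁
  have hzero : g₁ =ᶠ[nhds a] fun _ => 0 := by
    simpa [hderiv] using hconst.deriv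
  have := hzero.deriv_eq
  rw [hg₁.deriv, deriv_const] at this
  exact hneg.ne this

/-- The derivative of a function along a line. -/
theorem Differentiable.hasDerivAt_comp_line {E : Type*} [NormedAddCommGroup E] [NormedSpace ℝ E]
    {f : E → ℝ} (hf : Differentiable ℝ f) (p e : E) (t : ℝ) :
    HasDerivAt (fun s : ℝ => f (p + s • e)) (fderiv ℝ f (p + t • e) e) t := by
  have hline : HasDerivAt (fun s : ℝ => p + s • e) e t := by
    simpa using ((hasDerivAt_id t).smul_const e).const_add p
  exact (hf (p + t • e)).hasFDerivAt.comp_hasDerivAt t hline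

/-- If `M * u - (R ^ 2 - ‖x‖ ^ 2) ^ 2` has a local minimum at `p`, then its Laplacian there is
nonnegative. -/
theorem lap_ge_of_isLocalMin_barrier {n : ℕ} {u : EuclideanSpace ℝ (Fin n) → ℝ}
    (hu : ContDiff ℝ 2 u) (M R : ℝ) (p : EuclideanSpace ℝ (Fin n))
    (hmin : IsLocalMin (fun x => M * u x - (R ^ 2 - ‖x‖ ^ 2) ^ 2) p) :
    8 * ‖p‖ ^ 2 - 4 * n * (R ^ 2 - ‖p‖ ^ 2) ≤ M * lap u p := by
  have key : ∀ i : Fin n, 8 * p i ^ 2 - 4 * (R ^ 2 - ‖p‖ ^ 2) ≤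
      M * fderiv ℝ (fun y => fderiv ℝ u y (EuclideanSpace.single i 1)) p
        (EuclideanSpace.single i 1) := by
    intro i
    set e : EuclideanSpace ℝ (Fin n) := EuclideanSpace.single i 1
    have hnorm : ∀ t : ℝ, ‖p + t • e‖ ^ 2 = ‖p‖ ^ 2 + 2 * t * p i + t ^ 2 := by
      intro t
      rw [norm_add_sq_real, inner_smul_right, norm_smul]
      simp [e, EuclideanSpace.inner_single_right]
      ring
    have hdu : Differentiable ℝ (fun y => fderiv ℝ u y e) :=
      ((hu.fderiv_right (m := 1) (by norm_num)).clm_apply contDiff_const).differentiable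
        (by norm_num)
    have hq : ∀ t : ℝ, HasDerivAt (fun s : ℝ => R ^ 2 - (‖p‖ ^ 2 + 2 * s * p i + s ^ 2))
        (-(2 * p i + 2 * t)) t := by
      intro t
      have h := (((((hasDerivAt_id t).const_mul 2).mul_const (p i)).const_add (‖p‖ ^ 2)).add
        ((hasDerivAt_id t).pow 2)).const_sub (R ^ 2)
      refine h.congr_deriv ?_
      simp
    have hlmin : IsLocalMin (fun s : ℝ => M * u (p + s • e) -
        (R ^ 2 - (‖p‖ ^ 2 + 2 * s * p i + s ^ 2)) ^ 2) 0 := by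
      have hc : ContinuousAt (fun s : ℝ => p + s • e) 0 := by fun_prop
      have hmin' : IsLocalMin (fun x => M * u x - (R ^ 2 - ‖x‖ ^ 2) ^ 2) (p + (0 : ℝ) • e) := by
        simpa using hmin
      simpa only [IsLocalMin, Function.comp_def, hnorm] using hmin'.comp_tendsto (g := fun s : ℝ => p + s • e) hc
    have h₁ : ∀ t : ℝ, HasDerivAt (fun s : ℝ => M * u (p + s • e) -
        (R ^ 2 - (‖p‖ ^ 2 + 2 * s * p i + s ^ 2)) ^ 2)
        (M * fderiv ℝ u (p + t • e) e -
          2 * (R ^ 2 - (‖p‖ ^ 2 + 2 * t * p i + t ^ 2)) * (-(2 * p i + 2 * t))) t := by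
      intro t
      have h := (((hu.differentiable (by norm_num)).hasDerivAt_comp_line p e t).const_mul M).sub
        ((hq t).pow 2)
      refine h.congr_deriv ?_
      simp
    have h₂ : HasDerivAt (fun t : ℝ => M * fderiv ℝ u (p + t • e) e -
          2 * (R ^ 2 - (‖p‖ ^ 2 + 2 * t * p i + t ^ 2)) * (-(2 * p i + 2 * t)))
        (M * fderiv ℝ (fun y => fderiv ℝ u y e) p e -
          (8 * p i ^ 2 - 4 * (R ^ 2 - ‖p‖ ^ 2))) 0 := by
      have hl : HasDerivAt (fun t : ℝ => -(2 * p i + 2 * t)) (-(2 * 1)) 0 :=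
        (((hasDerivAt_id (0 : ℝ)).const_mul 2).const_add (2 * p i)).neg
      have h := ((hdu.hasDerivAt_comp_line p e 0).const_mul M).sub
        (((hq 0).const_mul 2).mul hl)
      refine h.congr_deriv ?_
      simp
      ring
    linarith [hlmin.second_deriv_nonneg h₁ h₂]
  have hsum := Finset.sum_le_sum fun i (_ : i ∈ Finset.univ) => key i
  rw [← Finset.mul_sum, Finset.sum_sub_distrib, ← Finset.mul_sum,
    ← EuclideanSpace.real_norm_sq_eq] at hsum
  simp only [Finset.sum_const, Finset.card_univ, Fintype.card_fin, nsmul_eq_mul] at hsum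
  unfold lap
  linarith

/-- Liouville-type theorem (paper's Example 1.1(i) + Corollaries 1.3, 1.2, Euclidean
case): for `c > 0` and `d ≤ 0`, there is no smooth positive solution of
`Δu + c u^(d+1) = 0` on all of `ℝⁿ`. -/
theorem stmt_15 (n : ℕ) (hn : 1 ≤ n) (c d : ℝ) (hc : 0 < c) (hd : d ≤ 0) :
    ¬ ∃ u : EuclideanSpace ℝ (Fin n) → ℝ,
      ContDiff ℝ (⊤ : ℕ∞) u ∧ (∀ x, 0 < u x) ∧ (∀ x, lap u x + c * u x ^ (d + 1) = 0) := by
  rintro ⟨u, hu, hpos, heq⟩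
  set a : ℝ := c * u 0 ^ d with ha
  have ha0 : 0 < a := mul_pos hc (rpow_pos_of_pos (hpos 0) d)
  obtain ⟨R, hR, hRB⟩ : ∃ R : ℝ, 0 < R ∧ (4 * n + 8 : ℝ) ^ 2 < 32 * a * R ^ 2 := by
    have ht : Filter.Tendsto (fun R : ℝ => 32 * a * R ^ 2) Filter.atTop Filter.atTop :=
      (Filter.tendsto_pow_atTop two_ne_zero).const_mul_atTop (by positivity)
    exact ((Filter.eventually_gt_atTop 0).and (ht.eventually_gt_atTop _)).exists
  obtain ⟨p, hp, hpmax⟩ := (isCompact_closedBall (0 : EuclideanSpace ℝ (Fin n)) R).exists_isMaxOn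
    ⟨0, by simp [hR.le]⟩ (f := fun x => (R ^ 2 - ‖x‖ ^ 2) ^ 2 / u x)
    (Continuous.continuousOn (by
      have := hu.continuous
      exact Continuous.div (by fun_prop) this fun x => (hpos x).ne'))
  set M : ℝ := (R ^ 2 - ‖p‖ ^ 2) ^ 2 / u p with hM
  have hMu : M * u p = (R ^ 2 - ‖p‖ ^ 2) ^ 2 := div_mul_cancel₀ _ (hpos p).ne'
  have hle : ∀ x ∈ closedBall (0 : EuclideanSpace ℝ (Fin n)) R,
      (R ^ 2 - ‖x‖ ^ 2) ^ 2 ≤ M * u x := fun x hx => (div_le_iff₀ (hpos x)).1 (hpmax hx)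
  have h0 : (R ^ 2) ^ 2 ≤ M * u 0 := by simpa using hle 0 (by simp [hR.le])
  have hM0 : 0 < M := pos_of_mul_pos_left (lt_of_lt_of_le (by positivity) h0) (hpos 0).le
  have hpR : ‖p‖ ≤ R := by simpa using hp
  have hpR' : ‖p‖ < R := by
    refine hpR.lt_of_ne fun h => ?_
    rw [h, sub_self, zero_pow two_ne_zero] at hMu
    exact (mul_pos hM0 (hpos p)).ne' hMu
  have hφ : 0 ≤ R ^ 2 - ‖p‖ ^ 2 := by nlinarith [norm_nonneg p]
  have hup : u p ≤ u 0 := by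
    refine le_of_mul_le_mul_left ?_ hM0
    rw [hMu]
    refine le_trans ?_ h0
    gcongr
    nlinarith [norm_nonneg p]
  have hmin : IsLocalMin (fun x => M * u x - (R ^ 2 - ‖x‖ ^ 2) ^ 2) p := by
    filter_upwards [closedBall_mem_nhds_of_mem (show p ∈ ball 0 R by simpa using hpR')] with x hx
    linarith [hle x hx]
  have hlap := lap_ge_of_isLocalMin_barrier (hu.of_le (WithTop.coe_le_coe.2 le_top)) M R p hmin
  have hrpow : u 0 ^ d ≤ u p ^ d := rpow_le_rpow_of_nonpos (hpos p) hup hd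
  have hlap' : M * lap u p = -(c * u p ^ d * (R ^ 2 - ‖p‖ ^ 2) ^ 2) := by
    have := heq p
    rw [rpow_add_one (hpos p).ne'] at this
    rw [← hMu]
    linear_combination M * this
  have hcmp : a * (R ^ 2 - ‖p‖ ^ 2) ^ 2 ≤ c * u p ^ d * (R ^ 2 - ‖p‖ ^ 2) ^ 2 := by
    rw [ha]
    gcongr
  set φ := R ^ 2 - ‖p‖ ^ 2
  have hquad : a * φ ^ 2 + 8 * R ^ 2 ≤ (4 * n + 8) * φ := by
    have : ‖p‖ ^ 2 = R ^ 2 - φ := by ring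
    nlinarith
  nlinarith [sq_nonneg (2 * a * φ - (4 * n + 8)), mul_le_mul_of_nonneg_left hquad ha0.le]
end

section
/- Let n ≥ 1 and let c₁, …, c_k ≥ 0 (not all zero) and d₁, …, d_k ≤ 0 be real constants. There is no smooth positive function u : ℝⁿ → ℝ satisfying Δu + Σ_{i=1}^{k} c_i·u^{d_i+1} = 0 on all of ℝⁿ. -/
open Real Metric

open scoped Topology in
/-- Second-order necessary condition for a local minimum on the real line. -/
theorem IsLocalMin.nonneg_of_hasDerivAt_hasDerivAt {g g' : ℝ → ℝ} {g'' x : ℝ}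
    (hmin : IsLocalMin g x) (hg : ∀ t, HasDerivAt g (g' t) t) (hg' : HasDerivAt g' g'' x) :
    0 ≤ g'' := by
  by_contra! hneg
  have hd : deriv g = g' := funext fun t => (hg t).deriv
  have hmax : IsLocalMax g x := by
    refine isLocalMax_of_deriv_deriv_neg ?_ hmin.deriv_eq_zero (hg x).continuousAt
    rwa [hd, hg'.deriv]
  have hconst : g =ᶠ[𝓝 x] fun _ => g x := by
    filter_upwards [hmin, hmax] with t h1 h2 using le_antisymm h2 h1
  have hzero : g' =ᶠ[𝓝 x] fun _ => 0 := by
    have := hconst.deriv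
    rw [hd] at this
    simpa using this
  have : g'' = 0 := hg'.unique ((hasDerivAt_const x (0 : ℝ)).congr_of_eventuallyEq hzero)
  exact hneg.ne this

/-- If `M * u - (1 - a‖·‖²)²` has a local minimum at `x`, then `M * Δu` dominates the Laplacian
of `(1 - a‖·‖²)²` at `x`. -/
theorem le_mul_lap_of_isLocalMin {n : ℕ} {u : EuclideanSpace ℝ (Fin n) → ℝ}
    (hu : ContDiff ℝ (⊤ : ℕ∞) u) {M a : ℝ} {x : EuclideanSpace ℝ (Fin n)}
    (hmin : IsLocalMin (fun y => M * u y - (1 - a * ‖y‖ ^ 2) ^ 2) x) :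
    8 * a ^ 2 * ‖x‖ ^ 2 - 4 * n * a * (1 - a * ‖x‖ ^ 2) ≤ M * lap u x := by
  have key : ∀ i : Fin n, 8 * a ^ 2 * x i ^ 2 - 4 * a * (1 - a * ‖x‖ ^ 2) ≤
      M * fderiv ℝ (fun y => fderiv ℝ u y (EuclideanSpace.single i 1)) x
        (EuclideanSpace.single i 1) := by
    intro i
    set e : EuclideanSpace ℝ (Fin n) := EuclideanSpace.single i 1 with he
    have hline : ∀ t : ℝ, HasDerivAt (fun t : ℝ => x + t • e) e t := fun t => by
      simpa using ((hasDerivAt_id t).smul_const e).const_add x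
    have hnorm : ∀ t : ℝ, ‖x + t • e‖ ^ 2 = ‖x‖ ^ 2 + 2 * t * x i + t ^ 2 := fun t => by
      rw [norm_add_sq_real, inner_smul_right, norm_smul, he, EuclideanSpace.inner_single_right]
      simp
      ring
    have hdu : ∀ t : ℝ, HasDerivAt (fun t : ℝ => u (x + t • e)) (fderiv ℝ u (x + t • e) e) t :=
      fun t => (hu.differentiable (by simp) _).hasFDerivAt.comp_hasDerivAt t (hline t)
    have hfd : Differentiable ℝ (fun y => fderiv ℝ u y e) :=
      ((hu.fderiv_right (m := 1) (WithTop.coe_le_coe.2 le_top)).differentiable (by simp)).clm_apply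
        (differentiable_const e)
    have hddu : HasDerivAt (fun t : ℝ => fderiv ℝ u (x + t • e) e)
        (fderiv ℝ (fun y => fderiv ℝ u y e) x e) 0 := by
      have h := (hfd (x + (0 : ℝ) • e)).hasFDerivAt.comp_hasDerivAt (0 : ℝ) (hline 0)
      rw [zero_smul, add_zero] at h
      exact h
    have hq : ∀ t : ℝ, HasDerivAt (fun t : ℝ => 1 - a * (‖x‖ ^ 2 + 2 * t * x i + t ^ 2))
        (-(a * (2 * x i + 2 * t))) t := fun t => by
      have h := (((((hasDerivAt_id t).const_mul 2).mul_const (x i)).const_add (‖x‖ ^ 2)).add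
        (hasDerivAt_pow 2 t)).const_mul a |>.const_sub 1
      exact h.congr_deriv (by simp)
    have hr : HasDerivAt (fun t : ℝ => -(a * (2 * x i + 2 * t))) (-(a * 2)) 0 := by
      have h := ((((hasDerivAt_id (0 : ℝ)).const_mul 2).const_add (2 * x i)).const_mul a).neg
      exact h.congr_deriv (by simp)
    have hmin' : IsLocalMin (fun t : ℝ => M * u (x + t • e) -
        (1 - a * (‖x‖ ^ 2 + 2 * t * x i + t ^ 2)) ^ 2) 0 := by
      have h : IsLocalMin ((fun y => M * u y - (1 - a * ‖y‖ ^ 2) ^ 2) ∘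
          fun t : ℝ => x + t • e) 0 :=
        IsLocalMin.comp_continuous (by simpa using hmin) (hline 0).continuousAt
      simpa only [Function.comp_def, hnorm] using h
    have h := hmin'.nonneg_of_hasDerivAt_hasDerivAt
      (fun t => ((hdu t).const_mul M).sub ((hq t).pow 2))
      ((hddu.const_mul M).sub ((((hq 0).pow 1).const_mul 2).mul hr))
    simp at h
    nlinarith
  have hsum := Finset.sum_le_sum fun i (_ : i ∈ Finset.univ) => key i
  rw [Finset.sum_sub_distrib, ← Finset.mul_sum, ← Finset.mul_sum,
    ← EuclideanSpace.real_norm_sq_eq] at hsum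
  simp only [Finset.sum_const, Finset.card_univ, Fintype.card_fin, nsmul_eq_mul] at hsum
  rw [lap, Finset.mul_sum]
  linarith

/-- Liouville-type theorem (paper's Example 1.1(ii) + Corollaries 1.3, 1.2, Euclidean
case): for `cᵢ ≥ 0` not all zero and `dᵢ ≤ 0`, there is no smooth positive solution of
`Δu + Σᵢ cᵢ u^(dᵢ+1) = 0` on all of `ℝⁿ`. -/
theorem stmt_16 (n : ℕ) (hn : 1 ≤ n) (k : ℕ) (c d : Fin k → ℝ)
    (hc : ∀ i, 0 ≤ c i) (hcne : ∃ i, c i ≠ 0) (hd : ∀ i, d i ≤ 0) :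
    ¬ ∃ u : EuclideanSpace ℝ (Fin n) → ℝ,
      ContDiff ℝ (⊤ : ℕ∞) u ∧ (∀ x, 0 < u x) ∧
      (∀ x, lap u x + ∑ i : Fin k, c i * u x ^ (d i + 1) = 0) := by
  rintro ⟨u, hu, hpos, heq⟩
  have hε : 0 < ∑ i, c i * u 0 ^ d i := by
    obtain ⟨j, hj⟩ := hcne
    exact Finset.sum_pos' (fun i _ => mul_nonneg (hc i) (rpow_nonneg (hpos 0).le _))
      ⟨j, Finset.mem_univ j, mul_pos ((hc j).lt_of_ne' hj) (rpow_pos_of_pos (hpos 0) _)⟩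
  set ε := ∑ i, c i * u 0 ^ d i with hεdef
  obtain ⟨a, ha⟩ : ∃ a : ℝ, a = ε / (n + 2) ^ 2 := ⟨_, rfl⟩
  have ha0 : 0 < a := by rw [ha]; positivity
  have hball : ∀ y : EuclideanSpace ℝ (Fin n),
      y ∈ closedBall 0 (√(1 / a)) ↔ a * ‖y‖ ^ 2 ≤ 1 := fun y => by
    rw [mem_closedBall_zero_iff, Real.le_sqrt (norm_nonneg y) (by positivity),
      le_div_iff₀' ha0]
  have hcont : Continuous fun y => (1 - a * ‖y‖ ^ 2) ^ 2 / u y :=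
    Continuous.div (by fun_prop) hu.continuous fun y => (hpos y).ne'
  obtain ⟨x, hxK, hx⟩ := (isCompact_closedBall (0 : EuclideanSpace ℝ (Fin n))
    (√(1 / a))).exists_isMaxOn ⟨0, by simp⟩ hcont.continuousOn
  obtain ⟨M, hM⟩ : ∃ M, M = (1 - a * ‖x‖ ^ 2) ^ 2 / u x := ⟨_, rfl⟩
  have hle : ∀ y : EuclideanSpace ℝ (Fin n), a * ‖y‖ ^ 2 ≤ 1 →
      (1 - a * ‖y‖ ^ 2) ^ 2 ≤ M * u y := fun y hy => by
    rw [← div_le_iff₀ (hpos y), hM]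
    exact hx ((hball y).2 hy)
  have hMx : M * u x = (1 - a * ‖x‖ ^ 2) ^ 2 := by
    rw [hM, div_mul_cancel₀ _ (hpos x).ne']
  have hM0 : 1 ≤ M * u 0 := by simpa using hle 0 (by simp)
  have hMpos : 0 < M := pos_of_mul_pos_left (by linarith) (hpos 0).le
  have hx1 : a * ‖x‖ ^ 2 < 1 := by
    refine lt_of_le_of_ne ((hball x).1 hxK) fun h => ?_
    rw [h] at hMx
    have := mul_pos hMpos (hpos x)
    norm_num at hMx
    rcases hMx with h | h <;> simp [h] at this
  have hmin : IsLocalMin (fun y => M * u y - (1 - a * ‖y‖ ^ 2) ^ 2) x := by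
    have hnear : ∀ᶠ y in nhds x, a * ‖y‖ ^ 2 < 1 :=
      ContinuousAt.eventually_lt (by fun_prop) continuousAt_const hx1
    filter_upwards [hnear] with y hy
    have := hle y hy.le
    linarith
  have hlap := le_mul_lap_of_isLocalMin hu hmin
  have hux : u x ≤ u 0 := by
    have hax : 0 ≤ a * ‖x‖ ^ 2 := by positivity
    refine le_of_mul_le_mul_left ?_ hMpos
    nlinarith
  have hS : ε * u x ≤ ∑ i, c i * u x ^ (d i + 1) := by
    rw [hεdef, Finset.sum_mul]
    refine Finset.sum_le_sum fun i _ => ?_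
    rw [rpow_add_one (hpos x).ne', ← mul_assoc]
    have := rpow_le_rpow_of_nonpos (hpos x) hux (hd i)
    have := hc i
    have := hpos x
    gcongr
  have hupper : M * lap u x ≤ -(ε * (1 - a * ‖x‖ ^ 2) ^ 2) := by
    rw [← hMx, eq_neg_of_add_eq_zero_left (heq x)]
    nlinarith
  have hsq : 8 * a ^ 2 * ‖x‖ ^ 2 - 4 * n * a * (1 - a * ‖x‖ ^ 2) =
      ε / 2 * (1 - a * ‖x‖ ^ 2 - 4 / (n + 2)) ^ 2 - ε / 2 * (1 - a * ‖x‖ ^ 2) ^ 2 := by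
    have hεa : ε = a * (n + 2) ^ 2 := by rw [ha]; field_simp
    rw [hεa]
    field_simp
    ring
  have h1 : 0 < ε * (1 - a * ‖x‖ ^ 2) ^ 2 := mul_pos hε (pow_pos (by linarith) 2)
  have h2 : 0 ≤ ε / 2 * (1 - a * ‖x‖ ^ 2 - 4 / (n + 2)) ^ 2 := by positivity
  linarith
end
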